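/- Assume κ > λ ≥ μ ≥ ω are cardinals with κ regular, and Stick(κ, λ, μ) holds: there is a μ-almost disjoint family A ⊆ [κ]^λ with |A| = κ such that every X ∈ [κ]^κ contains some member of A. Then M(κ, κ, μ) ↛ B(λ): there exists a μ-almost disjoint family Y ⊆ [κ]^κ with |Y| = κ that has no λ-transversal. -/

import Mathlib

open Set Cardinal

universe u

/-- If the sets `D i` are pairwise disjoint, the sets `E i` are pairwise `μ`-almost disjoint and
each `D i` meets each `E j` in at most one point, then the sets `D i ∪ E i` are pairwise
`μ`-almost disjoint. -/
theorem mk_union_inter_union_lt {α ι : Type u} {μ : Cardinal.{u}} (hμ : ℵ₀ ≤ μ)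
    {D E : ι → Set α} (hD : ∀ i j, i ≠ j → Disjoint (D i) (D j))
    (hE : ∀ i j, i ≠ j → #↥(E i ∩ E j) < μ) (hDE : ∀ i j, (D i ∩ E j).Subsingleton)
    {i j : ι} (hij : i ≠ j) : #↥((D i ∪ E i) ∩ (D j ∪ E j)) < μ := by
  have hsub : (D i ∪ E i) ∩ (D j ∪ E j) ⊆ (E i ∩ E j) ∪ ((D i ∩ E j) ∪ (D j ∩ E i)) := by
    rintro x ⟨hx | hx, hy | hy⟩
    · exact (Set.disjoint_left.1 (hD i j hij) hx hy).elim
    · exact Or.inr (Or.inl ⟨hx, hy⟩)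
    · exact Or.inr (Or.inr ⟨hy, hx⟩)
    · exact Or.inl ⟨hx, hy⟩
  have hone : ∀ s : Set α, s.Subsingleton → #↥s < μ := fun s hs =>
    (mk_le_one_iff_set_subsingleton.2 hs).trans_lt (one_lt_aleph0.trans_le hμ)
  calc #↥((D i ∪ E i) ∩ (D j ∪ E j))
      ≤ #↥((E i ∩ E j) ∪ ((D i ∩ E j) ∪ (D j ∩ E i))) := mk_le_mk_of_subset hsub
    _ ≤ #↥(E i ∩ E j) + #↥((D i ∩ E j) ∪ (D j ∩ E i)) := mk_union_le _ _
    _ < μ := add_lt_of_lt hμ (hE i j hij) ((mk_union_le _ _).trans_lt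
      (add_lt_of_lt hμ (hone _ (hDE i j)) (hone _ (hDE j i))))

/-- An infinite type maps to any nonempty type of at most its size so that all fibres are of
full size. -/
theorem exists_forall_mk_preimage_singleton_eq {α ι : Type u} (hα : ℵ₀ ≤ #α) (hι : #ι ≤ #α)
    (hι₀ : #ι ≠ 0) : ∃ π : α → ι, ∀ i, #↥(π ⁻¹' {i}) = #α := by
  have hcard : #α = #(ι × α) := by
    rw [mk_prod, lift_id, lift_id, mul_eq_right hα hι hι₀]
  obtain ⟨e⟩ := Cardinal.eq.1 hcard
  refine ⟨fun x => (e x).1, fun i => le_antisymm (mk_set_le _) ?_⟩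
  refine mk_le_of_injective (f := fun a => ⟨e.symm (i, a), by simp⟩) fun a b hab => ?_
  simpa using hab

/-- Stick(κ,λ,μ) implies M(κ,κ,μ) ↛ B(λ). -/
theorem stmt5 {α : Type u} (κ lam μ : Cardinal.{u})
    (hκ : κ.IsRegular) (hα : #α = κ)
    (hμ : ℵ₀ ≤ μ) (hμlam : μ ≤ lam) (hlamκ : lam < κ)
    (𝒜 : Set (Set α)) (h𝒜 : #↥𝒜 = κ) (hsz : ∀ A ∈ 𝒜, #↥A = lam)
    (had : ∀ A ∈ 𝒜, ∀ B ∈ 𝒜, A ≠ B → #↥(A ∩ B) < μ)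
    (hstick : ∀ X : Set α, #↥X = κ → ∃ A ∈ 𝒜, A ⊆ X) :
    ∃ 𝒴 : Set (Set α), #↥𝒴 = κ ∧ (∀ Y ∈ 𝒴, #↥Y = κ) ∧
      (∀ Y ∈ 𝒴, ∀ Y' ∈ 𝒴, Y ≠ Y' → #↥(Y ∩ Y') < μ) ∧
      ¬ ∃ T : Set α, ∀ Y ∈ 𝒴, 0 < #↥(Y ∩ T) ∧ #↥(Y ∩ T) < lam := by
  have hκ₀ : ℵ₀ ≤ κ := hκ.aleph0_le
  have hι : #(α ⊕ ↥𝒜) = κ := by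
    rw [mk_sum, lift_id, lift_id, hα, h𝒜, add_eq_self hκ₀]
  obtain ⟨π, hπ⟩ := exists_forall_mk_preimage_singleton_eq (α := α) (ι := α ⊕ ↥𝒜)
    (by rwa [hα]) (by rw [hι, hα]) (by rw [hι]; exact (aleph0_pos.trans_le hκ₀).ne')
  rw [hα] at hπ
  -- the members of `𝒜` that are partial selectors for the partition into fibres of `π`
  let E : α ⊕ ↥𝒜 → Set α := Sum.elim (fun _ => ∅) (fun A => {x | x ∈ A.1 ∧ InjOn π A.1})
  let Y : α ⊕ ↥𝒜 → Set α := fun i => π ⁻¹' {i} ∪ E i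
  have hYκ : ∀ i, #↥(Y i) = κ := fun i =>
    le_antisymm (hα ▸ mk_set_le _) (hπ i ▸ mk_le_mk_of_subset subset_union_left)
  have hY : ∀ i j, i ≠ j → #↥(Y i ∩ Y j) < μ := by
    intro i j hij
    refine mk_union_inter_union_lt hμ (D := fun i => π ⁻¹' {i}) ?_ ?_ ?_ hij
    · intro i j hij
      exact Disjoint.preimage π (disjoint_singleton.2 hij)
    · have hμ₀ : 0 < μ := aleph0_pos.trans_le hμ
      rintro (a | A) (b | B) hAB
      · simpa [E] using hμ₀
      · simpa [E] using hμ₀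
      · simpa [E] using hμ₀
      · refine (mk_le_mk_of_subset ?_).trans_lt (had A.1 A.2 B.1 B.2 fun h => hAB ?_)
        · exact fun x hx => ⟨hx.1.1, hx.2.1⟩
        · rw [Subtype.ext h]
    · rintro i (b | B) x ⟨hx, hxE⟩ y ⟨hy, hyE⟩
      · exact hxE.elim
      · exact hxE.2 hxE.1 hyE.1 (hx.trans hy.symm)
  have hYinj : Function.Injective Y := by
    intro i j hij
    by_contra hne
    have hlt := hY i j hne
    rw [← hij, inter_self, hYκ] at hlt
    exact (hlt.trans_le (hμlam.trans hlamκ.le)).false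
  refine ⟨range Y, (mk_range_eq Y hYinj).trans hι, ?_, ?_, ?_⟩
  · rintro _ ⟨i, rfl⟩
    exact hYκ i
  · rintro _ ⟨i, rfl⟩ _ ⟨j, rfl⟩ hij
    exact hY i j fun h => hij (congrArg Y h)
  · rintro ⟨T, hT⟩
    have hsel : ∀ a : α, ∃ x ∈ T, π x = Sum.inl a := by
      intro a
      obtain ⟨⟨x, hx | hx, hxT⟩⟩ := mk_ne_zero_iff.1 (hT _ ⟨Sum.inl a, rfl⟩).1.ne'
      · exact ⟨x, hxT, hx⟩
      · exact hx.elim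
    choose s hsT hsπ using hsel
    have hs : Function.Injective s := fun a b hab =>
      Sum.inl_injective ((hsπ a).symm.trans ((congrArg π hab).trans (hsπ b)))
    obtain ⟨A, hA, hAs⟩ := hstick (range s) ((mk_range_eq s hs).trans hα)
    have hAinj : InjOn π A := by
      intro x hx y hy hxy
      obtain ⟨a, rfl⟩ := hAs hx
      obtain ⟨b, rfl⟩ := hAs hy
      rw [hsπ, hsπ] at hxy
      rw [Sum.inl_injective hxy]
    refine (hT _ ⟨Sum.inr ⟨A, hA⟩, rfl⟩).2.not_ge ?_
    rw [← hsz A hA]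
    refine mk_le_mk_of_subset fun x hx => ⟨Or.inr ⟨hx, hAinj⟩, ?_⟩
    obtain ⟨a, rfl⟩ := hAs hx
    exact hsT a
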